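/- arXiv:2506.12146 — 2 statements merged into one kernel-verified Lean document; each statement's English description precedes it below -/
import Mathlib

section
/- If G is a periodic (torsion) group, then the subgroup R = ⁅⁅G₁,L⁆,G₂⁆ of the weak commutativity group χ(G) is periodic, i.e. every element of R has finite order. -/
open Subgroup

/-- The weak commutativity relations inside the free product `G ∗ G`. -/
def chiRel (G : Type*) [Group G] : Subgroup (Monoid.Coprod G G) :=
  Subgroup.normalClosure
    {x | ∃ g : G, x = Monoid.Coprod.inl g * Monoid.Coprod.inr g *
      (Monoid.Coprod.inl g)⁻¹ * (Monoid.Coprod.inr g)⁻¹}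

instance chiRel_normal (G : Type*) [Group G] : (chiRel G).Normal :=
  Subgroup.normalClosure_normal

/-- The weak commutativity group `χ(G)`. -/
def Chi (G : Type*) [Group G] : Type _ := Monoid.Coprod G G ⧸ chiRel G

instance (G : Type*) [Group G] : Group (Chi G) :=
  inferInstanceAs (Group (Monoid.Coprod G G ⧸ chiRel G))

/-- The canonical map `G → χ(G)`, `g ↦ g`. -/
def chiIota1 (G : Type*) [Group G] : G →* Chi G :=
  (QuotientGroup.mk' (chiRel G)).comp Monoid.Coprod.inl

/-- The canonical map `G → χ(G)`, `g ↦ g^φ`. -/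
def chiIota2 (G : Type*) [Group G] : G →* Chi G :=
  (QuotientGroup.mk' (chiRel G)).comp Monoid.Coprod.inr

/-- `G₁ ≤ χ(G)`. -/
def chiG1 (G : Type*) [Group G] : Subgroup (Chi G) := (chiIota1 G).range

/-- `G₂ = G^φ ≤ χ(G)`. -/
def chiG2 (G : Type*) [Group G] : Subgroup (Chi G) := (chiIota2 G).range

/-- `L = ⟨g⁻¹ g^φ : g ∈ G⟩`. -/
def chiL (G : Type*) [Group G] : Subgroup (Chi G) :=
  Subgroup.closure {x | ∃ g : G, x = (chiIota1 G g)⁻¹ * chiIota2 G g}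

/-- `D = ⁅G₁, G₂⁆`. -/
def chiD (G : Type*) [Group G] : Subgroup (Chi G) := ⁅chiG1 G, chiG2 G⁆

/-- `L₁ = ⁅L, G₁⁆`. -/
def chiL1 (G : Type*) [Group G] : Subgroup (Chi G) := ⁅chiL G, chiG1 G⁆

/-- `L₂ = ⁅L, G₂⁆`. -/
def chiL2 (G : Type*) [Group G] : Subgroup (Chi G) := ⁅chiL G, chiG2 G⁆

/-- `R = ⁅⁅G₁, L⁆, G₂⁆`. -/
def chiR (G : Type*) [Group G] : Subgroup (Chi G) := ⁅⁅chiG1 G, chiL G⁆, chiG2 G⁆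

/-- `L₁₂ = ⁅L₁, L₂⁆`. -/
def chiL12 (G : Type*) [Group G] : Subgroup (Chi G) := ⁅chiL1 G, chiL2 G⁆


open scoped commutatorElement

section helpers

variable {G : Type*} [Group G]

theorem chi_ind {P : Chi G → Prop} (h1 : ∀ g, P (chiIota1 G g)) (h2 : ∀ g, P (chiIota2 G g))
    (hm : ∀ x y, P x → P y → P (x * y)) (x : Chi G) : P x := by
  obtain ⟨y, rfl⟩ := QuotientGroup.mk'_surjective (chiRel G) x
  induction y using Monoid.Coprod.induction_on with
  | inl g => exact h1 g
  | inr g => exact h2 g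
  | mul y z hy hz =>
    exact hm _ _ hy hz

theorem chi_rel (g : G) : chiIota1 G g * chiIota2 G g = chiIota2 G g * chiIota1 G g := by
  have h : (Monoid.Coprod.inl g * Monoid.Coprod.inr g *
      (Monoid.Coprod.inl g)⁻¹ * (Monoid.Coprod.inr g)⁻¹ : Monoid.Coprod G G) ∈ chiRel G :=
    Subgroup.subset_normalClosure ⟨g, rfl⟩
  have h2 : chiIota1 G g * chiIota2 G g * (chiIota1 G g)⁻¹ * (chiIota2 G g)⁻¹ = 1 :=
    (QuotientGroup.eq_one_iff _).2 h
  rw [mul_inv_eq_one, mul_inv_eq_iff_eq_mul] at h2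
  exact h2

/-- Normality of a closure, checked on generators. -/
theorem chi_normal_closure (S : Set (Chi G))
    (h1 : ∀ g, ∀ s ∈ S, chiIota1 G g * s * (chiIota1 G g)⁻¹ ∈ closure S)
    (h2 : ∀ g, ∀ s ∈ S, chiIota2 G g * s * (chiIota2 G g)⁻¹ ∈ closure S) :
    (closure S).Normal := by
  have key : ∀ c : Chi G, (∀ s ∈ S, c * s * c⁻¹ ∈ closure S) →
      ∀ s ∈ closure S, c * s * c⁻¹ ∈ closure S := by
    intro c hc s hs
    have : closure S ≤ (closure S).comap (MulAut.conj c).toMonoidHom := by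
      rw [closure_le]
      intro s hs
      simpa using hc s hs
    simpa using this hs
  constructor
  intro n hn x
  revert n
  induction x using chi_ind with
  | h1 g => exact key _ (h1 g)
  | h2 g => exact key _ (h2 g)
  | hm x y hx hy =>
    intro n hn
    have := hx _ (hy n hn)
    simpa [mul_assoc] using this

theorem chiL_normal : (chiL G).Normal := by
  have hl : ∀ g : G, (chiIota1 G g)⁻¹ * chiIota2 G g ∈ chiL G := fun g =>
    subset_closure ⟨g, rfl⟩
  have h1 : ∀ g k : G, chiIota1 G g * ((chiIota1 G k)⁻¹ * chiIota2 G k) * (chiIota1 G g)⁻¹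
      ∈ chiL G := by
    intro g k
    have := mul_mem (hl (k * g⁻¹)) (inv_mem (hl g⁻¹))
    simpa [mul_assoc] using this
  have h1' : ∀ g : G, ∀ s ∈ chiL G, chiIota1 G g * s * (chiIota1 G g)⁻¹ ∈ chiL G := by
    intro g s hs
    have : chiL G ≤ (chiL G).comap (MulAut.conj (chiIota1 G g)).toMonoidHom := by
      conv_lhs => rw [chiL]
      rw [closure_le]
      rintro _ ⟨k, rfl⟩
      simpa using h1 g k
    simpa using this hs
  apply chi_normal_closure
  · rintro g _ ⟨k, rfl⟩
    exact h1 g k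
  · rintro g _ ⟨k, rfl⟩
    have := h1' g _ (mul_mem (mul_mem (hl g) (hl k)) (inv_mem (hl g)))
    simpa [mul_assoc, chiL] using this

theorem chiD_normal : (chiD G).Normal := by
  have hd : ∀ g h : G, ⁅chiIota1 G g, chiIota2 G h⁆ ∈ chiD G := fun g h =>
    commutator_mem_commutator ⟨g, rfl⟩ ⟨h, rfl⟩
  rw [chiD, Subgroup.commutator_def]
  apply chi_normal_closure
  · rintro k _ ⟨_, ⟨g, rfl⟩, _, ⟨h, rfl⟩, rfl⟩
    have := mul_mem (hd (k * g) h) (inv_mem (hd k h))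
    rw [chiD, Subgroup.commutator_def] at this
    simpa [mul_assoc, commutatorElement_def] using this
  · rintro k _ ⟨_, ⟨g, rfl⟩, _, ⟨h, rfl⟩, rfl⟩
    have := mul_mem (inv_mem (hd g k)) (hd g (k * h))
    rw [chiD, Subgroup.commutator_def] at this
    simpa [mul_assoc, commutatorElement_def] using this

theorem chi_swap (g h : G) :
    ⁅chiIota1 G g, chiIota2 G h⁆ = ⁅chiIota2 G g, chiIota1 G h⁆ := by
  have key : ∀ a b c d : Chi G, a * b = b * a → c * d = d * c →
      (a * c) * (b * d) = (b * d) * (a * c) → a⁻¹ * d * a * d⁻¹ = b⁻¹ * c * b * c⁻¹ := by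
    intro a b c d hab hcd h
    have e1 : c * b = a⁻¹ * (b * d * a * c) * d⁻¹ := by
      rw [← mul_assoc (b * d) a c] at h
      rw [← h]; group
    have hab' : b⁻¹ * a⁻¹ * b = a⁻¹ := by
      have : a⁻¹ * b = b * a⁻¹ := by
        rw [inv_mul_eq_iff_eq_mul, ← mul_assoc, hab]; group
      rw [mul_assoc, this]; group
    have hcd' : c * d⁻¹ * c⁻¹ = d⁻¹ := by
      have : c * d⁻¹ = d⁻¹ * c := by
        rw [mul_inv_eq_iff_eq_mul, mul_assoc, hcd]; group
      rw [this]; group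
    calc a⁻¹ * d * a * d⁻¹ = (b⁻¹ * a⁻¹ * b) * d * a * (c * d⁻¹ * c⁻¹) := by rw [hab', hcd']
      _ = b⁻¹ * (a⁻¹ * (b * d * a * c) * d⁻¹) * c⁻¹ := by group
      _ = b⁻¹ * (c * b) * c⁻¹ := by rw [← e1]
      _ = _ := by group
  have := key (chiIota1 G g⁻¹) (chiIota2 G g⁻¹) (chiIota1 G h) (chiIota2 G h)
    (chi_rel _) (chi_rel _) (by simpa using chi_rel (g⁻¹ * h))
  simpa [commutatorElement_def] using this

theorem chi_conj (g h k : G) :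
    chiIota1 G k * ⁅chiIota1 G g, chiIota2 G h⁆ * (chiIota1 G k)⁻¹ =
    chiIota2 G k * ⁅chiIota1 G g, chiIota2 G h⁆ * (chiIota2 G k)⁻¹ := by
  have e1 : chiIota1 G k * ⁅chiIota1 G g, chiIota2 G h⁆ * (chiIota1 G k)⁻¹ =
      ⁅chiIota1 G (k * g), chiIota2 G h⁆ * ⁅chiIota1 G k, chiIota2 G h⁆⁻¹ := by
    simp [commutatorElement_def, mul_assoc]
  rw [e1, chi_swap, chi_swap k, chi_swap g]
  simp [commutatorElement_def, mul_assoc]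

theorem chi_LD {l d : Chi G} (hl : l ∈ chiL G) (hd : d ∈ chiD G) : l * d = d * l := by
  have : chiL G ≤ centralizer (chiD G : Set (Chi G)) := by
    rw [chiL, closure_le]
    rintro _ ⟨k, rfl⟩
    have h2 : chiD G ≤ centralizer {(chiIota1 G k)⁻¹ * chiIota2 G k} := by
      rw [chiD, commutator_le]
      rintro _ ⟨g, rfl⟩ _ ⟨h, rfl⟩
      rw [mem_centralizer_singleton_iff]
      have e := chi_conj g h k
      generalize ⁅chiIota1 G g, chiIota2 G h⁆ = d at *
      generalize chiIota1 G k = x at *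
      generalize chiIota2 G k = y at *
      calc d * (x⁻¹ * y) = x⁻¹ * (x * d * x⁻¹) * y := by group
        _ = x⁻¹ * (y * d * y⁻¹) * y := by rw [e]
        _ = x⁻¹ * y * d := by group
    intro d hd
    exact ((mem_centralizer_singleton_iff).1 (h2 hd))
  exact (this hl d hd).symm

/-- Every element is `a(u) b(v)` modulo `D`. -/
theorem chi_decomp {K : Type*} [Group K] (q : Chi G →* K)
    (hq : ∀ d ∈ chiD G, q d = 1) (x : Chi G) :
    ∃ u v, q x = q (chiIota1 G u) * q (chiIota2 G v) := by
  induction x using chi_ind with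
  | h1 g => exact ⟨g, 1, by simp⟩
  | h2 g => exact ⟨1, g, by simp⟩
  | hm x y hx hy =>
    obtain ⟨u, v, h⟩ := hx
    obtain ⟨u', v', h'⟩ := hy
    have hc : q (chiIota1 G u') * q (chiIota2 G v) = q (chiIota2 G v) * q (chiIota1 G u') := by
      have := hq _ (commutator_mem_commutator (⟨u', rfl⟩ : _ ∈ chiG1 G) (⟨v, rfl⟩ : _ ∈ chiG2 G))
      rw [map_commutatorElement, commutatorElement_eq_one_iff_mul_comm] at this
      exact this
    refine ⟨u * u', v * v', ?_⟩
    simp only [map_mul, h, h', mul_assoc]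
    rw [← mul_assoc (q (chiIota2 G v)), ← hc]
    simp only [mul_assoc]

end helpers

theorem chiR_periodic_of_periodic (G : Type*) [Group G]
    (hG : ∀ g : G, ∃ n : ℕ, 0 < n ∧ g ^ n = 1) :
    ∀ x ∈ chiR G, ∃ n : ℕ, 0 < n ∧ x ^ n = 1 := by
  have hLn : (chiL G).Normal := chiL_normal
  have hDn : (chiD G).Normal := chiD_normal
  obtain ⟨q, hq⟩ : ∃ q : Chi G →* (Chi G ⧸ chiD G), ∀ d, q d = 1 ↔ d ∈ chiD G :=
    ⟨QuotientGroup.mk' _, fun d => QuotientGroup.eq_one_iff d⟩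
  have hab : ∀ u v, Commute (q (chiIota1 G u)) (q (chiIota2 G v)) := by
    intro u v
    have := (hq _).2 (commutator_mem_commutator (⟨u, rfl⟩ : _ ∈ chiG1 G) (⟨v, rfl⟩ : _ ∈ chiG2 G))
    rw [map_commutatorElement, commutatorElement_eq_one_iff_mul_comm] at this
    exact this
  have dec : ∀ x, ∃ u v, q x = q (chiIota1 G u) * q (chiIota2 G v) :=
    chi_decomp q (fun d hd => (hq d).2 hd)
  -- torsion modulo D
  have tor : ∀ x, ∃ n : ℕ, 0 < n ∧ x ^ n ∈ chiD G := by
    intro x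
    obtain ⟨u, v, h⟩ := dec x
    obtain ⟨n, hn, hn'⟩ := hG u
    obtain ⟨m, hm, hm'⟩ := hG v
    refine ⟨n * m, Nat.mul_pos hn hm, (hq _).1 ?_⟩
    rw [map_pow, h, (hab u v).mul_pow]
    simp only [← map_pow]
    rw [pow_mul, hn', mul_comm n m, pow_mul, hm']
    simp
  -- the elements of W commute with L
  have W1 : ∀ w ∈ chiD G, ∀ l ∈ chiL G, l * w = w * l := fun w hw l hl => chi_LD hl hw
  have W2 : ∀ w ∈ chiD G, ∀ l ∈ chiL G, l * w * l⁻¹ = w := fun w hw l hl => by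
    rw [W1 w hw l hl]; group
  have Lc : ∀ l ∈ chiL G, ∀ x, ⁅l, x⁆ ∈ chiL G := fun l hl x => by
    have := mul_mem hl (hLn.conj_mem _ (inv_mem hl) x)
    simpa [commutatorElement_def, mul_assoc] using this
  let T : Subgroup (Chi G) :=
    { carrier := {w | w ∈ chiL G ∧ w ∈ chiD G ∧ IsOfFinOrder w}
      one_mem' := ⟨one_mem _, one_mem _, IsOfFinOrder.one⟩
      mul_mem' := by
        rintro x y ⟨hx1, hx2, hx3⟩ ⟨hy1, hy2, hy3⟩
        exact ⟨mul_mem hx1 hy1, mul_mem hx2 hy2,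
          Commute.isOfFinOrder_mul (W1 y hy2 x hx1) hx3 hy3⟩
      inv_mem' := by
        rintro x ⟨hx1, hx2, hx3⟩
        exact ⟨inv_mem hx1, inv_mem hx2, hx3.inv⟩ }
  have hT : ∀ w, w ∈ T ↔ (w ∈ chiL G ∧ w ∈ chiD G ∧ IsOfFinOrder w) := fun w => Iff.rfl
  have hTn : T.Normal := by
    constructor
    rintro n ⟨h1, h2, h3⟩ g
    refine ⟨hLn.conj_mem _ h1 g, hDn.conj_mem _ h2 g, ?_⟩
    have := (MulAut.conj g).toMonoidHom.isOfFinOrder h3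
    simpa using this
  have Tpow : ∀ w ∈ chiL G, w ∈ chiD G → ∀ n : ℕ, 0 < n → w ^ n ∈ T → w ∈ T := by
    intro w h1 h2 n hn h
    refine ⟨h1, h2, ?_⟩
    exact (isOfFinOrder_pow.1 h.2.2).resolve_right hn.ne'
  have hA : ∀ (l : Chi G) (g : G), ∃ u, q ⁅l, chiIota1 G g⁆ = q (chiIota1 G u) := by
    intro l g
    obtain ⟨u, v, h⟩ := dec l
    refine ⟨⁅u, g⁆, ?_⟩
    rw [map_commutatorElement, h, map_commutatorElement, map_commutatorElement]
    have := (hab g v).eq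
    simp only [commutatorElement_def, mul_inv_rev, mul_assoc]
    rw [← mul_assoc (q (chiIota2 G v)), ← this]
    simp [mul_assoc]
  have hB : ∀ (l : Chi G) (h : G), ∃ v, q ⁅l, chiIota2 G h⁆ = q (chiIota2 G v) := by
    intro l g
    obtain ⟨u, v, h⟩ := dec l
    refine ⟨⁅v, g⁆, ?_⟩
    rw [map_commutatorElement, h, map_commutatorElement, map_commutatorElement]
    have h1 := (hab u ⁅v, g⁆).eq
    have h2 := (hab u g).eq
    simp only [map_commutatorElement] at h1
    calc _ = (q (chiIota1 G u) * ⁅q (chiIota2 G v), q (chiIota2 G g)⁆) *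
          (q (chiIota2 G g) * (q (chiIota1 G u))⁻¹ * (q (chiIota2 G g))⁻¹) := by
            simp [commutatorElement_def, mul_assoc]
      _ = _ := by
        rw [h1]
        have : q (chiIota2 G g) * (q (chiIota1 G u))⁻¹ = (q (chiIota1 G u))⁻¹ * q (chiIota2 G g) := by
          rw [mul_inv_eq_iff_eq_mul, mul_assoc, ← h2]; group
        rw [this]; group
  have hAB : ∀ x y : Chi G, (∃ u, q x = q (chiIota1 G u)) → (∃ v, q y = q (chiIota2 G v)) →
      ⁅x, y⁆ ∈ chiD G := by
    rintro x y ⟨u, hu⟩ ⟨v, hv⟩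
    rw [← hq, map_commutatorElement, commutatorElement_eq_one_iff_mul_comm, hu, hv]
    exact hab u v
  have L12 : ∀ x ∈ chiL G, ∀ y ∈ chiL G, (∃ u, q x = q (chiIota1 G u)) →
      (∃ v, q y = q (chiIota2 G v)) → ⁅x, y⁆ ∈ T := by
    intro x hx y hy hx' hy'
    have hD := hAB x y hx' hy'
    obtain ⟨n, hn, hn'⟩ := tor x
    refine ⟨Lc x hx y, hD, isOfFinOrder_iff_pow_eq_one.2 ⟨n, hn, ?_⟩⟩
    have : ∀ m : ℕ, ⁅x ^ m, y⁆ = ⁅x, y⁆ ^ m := by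
      intro m
      induction m with
      | zero => simp
      | succ m ih =>
        have e : ⁅x ^ (m + 1), y⁆ = (x * ⁅x ^ m, y⁆ * x⁻¹) * ⁅x, y⁆ := by
          rw [pow_succ']; simp [commutatorElement_def, mul_assoc]
        rw [e, ih, W2 _ (pow_mem hD m) x hx, pow_succ]
    rw [← this, commutatorElement_eq_one_iff_mul_comm]
    exact (W1 _ hn' y hy).symm
  -- the main multiplicativity
  have main : ∀ g h, ∀ l ∈ chiL G, ⁅⁅l, chiIota1 G g⁆, chiIota2 G h⁆ ∈ T := by
    intro g h
    obtain ⟨F, hF⟩ : ∃ F : Chi G → Chi G, ∀ l, F l = ⁅⁅l, chiIota1 G g⁆, chiIota2 G h⁆ :=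
      ⟨_, fun _ => rfl⟩
    have FL : ∀ l ∈ chiL G, F l ∈ chiL G := fun l hl => by
      rw [hF]; exact Lc _ (Lc _ hl _) _
    have FD : ∀ l, F l ∈ chiD G := fun l => by
      rw [hF]; exact hAB _ _ (hA _ _) ⟨h, rfl⟩
    have Fmul : ∀ l ∈ chiL G, ∀ l' ∈ chiL G, ∃ t ∈ T, F (l * l') = F l * (t * F l') := by
      intro l hl l' hl'
      refine ⟨⁅⁅l', chiIota1 G g⁆, ⁅l⁻¹, chiIota2 G h⁆⁆,
        L12 _ (Lc _ hl' _) _ (Lc _ (inv_mem hl) _) (hA _ _) (hB _ _), ?_⟩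
      have hx := Lc _ hl' (chiIota1 G g)
      have hFl := FD l
      have hFl' := FD l'
      have ht := hAB _ _ (hA l' g) (hB l⁻¹ h)
      have hy := Lc _ (inv_mem hl) (chiIota2 G h)
      have e0 : ⁅l * l', chiIota1 G g⁆ = l * ⁅l', chiIota1 G g⁆ * l⁻¹ * ⁅l, chiIota1 G g⁆ := by
        simp [commutatorElement_def, mul_assoc]
      rw [hF] at hFl hFl'
      rw [hF, hF, hF, e0]
      generalize ⁅l', chiIota1 G g⁆ = x at *
      generalize ⁅l, chiIota1 G g⁆ = z at *
      have e1 : ⁅l * x * l⁻¹ * z, chiIota2 G h⁆ =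
          ((l * x * l⁻¹) * ⁅z, chiIota2 G h⁆ * (l * x * l⁻¹)⁻¹) *
          (l * (⁅x, ⁅l⁻¹, chiIota2 G h⁆⁆ *
            (⁅l⁻¹, chiIota2 G h⁆ * ⁅x, chiIota2 G h⁆ * ⁅l⁻¹, chiIota2 G h⁆⁻¹)) * l⁻¹) := by
        simp [commutatorElement_def, mul_assoc]
      rw [e1, W2 _ hFl' _ hy, W2 _ (mul_mem ht hFl') _ hl, W2 _ hFl _ (hLn.conj_mem _ hx l)]
    have F1 : F 1 = 1 := by rw [hF]; simp
    have Fpow : ∀ l ∈ chiL G, ∀ n : ℕ, ∃ t ∈ T, F (l ^ n) = F l ^ n * t := by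
      intro l hl n
      induction n with
      | zero => exact ⟨1, one_mem _, by simp [F1]⟩
      | succ n ih =>
        obtain ⟨t, ht, e⟩ := ih
        obtain ⟨t', ht', e'⟩ := Fmul l hl (l ^ n) (pow_mem hl n)
        refine ⟨t' * t, mul_mem ht' ht, ?_⟩
        rw [pow_succ', e', e, ← mul_assoc t', W1 _ (pow_mem (FD l) n) _ ht'.1, pow_succ']
        simp only [mul_assoc]
    have Finv : ∀ l ∈ chiL G, F l ∈ T → F l⁻¹ ∈ T := by
      intro l hl h
      obtain ⟨t, ht, e⟩ := Fmul l hl l⁻¹ (inv_mem hl)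
      rw [mul_inv_cancel, F1, ← mul_assoc] at e
      rw [← inv_eq_of_mul_eq_one_right e.symm]
      exact inv_mem (mul_mem h ht)
    intro l hl
    rw [← hF]
    have hl2 := hl
    rw [chiL] at hl2
    induction hl2 using closure_induction with
    | mem x hx =>
      obtain ⟨k, rfl⟩ := hx
      obtain ⟨n, hn, hk⟩ := hG k
      have hz : ((chiIota1 G k)⁻¹ * chiIota2 G k) ^ n = 1 := by
        have c : Commute (chiIota1 G k) (chiIota2 G k) := chi_rel k
        rw [c.inv_left.mul_pow, inv_pow, ← map_pow, ← map_pow, hk]; simp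
      obtain ⟨t, ht, e⟩ := Fpow _ hl n
      rw [hz, F1] at e
      refine Tpow _ (FL _ hl) (FD _) n hn ?_
      rw [eq_inv_of_mul_eq_one_left e.symm]
      exact inv_mem ht
    | one => rw [F1]; exact one_mem _
    | mul x y hx hy ihx ihy =>
      obtain ⟨t, ht, e⟩ := Fmul x hx y hy
      rw [e]
      exact mul_mem (ihx hx) (mul_mem ht (ihy hy))
    | inv x hx ih => exact Finv x hx (ih hx)
  have RT : chiR G ≤ T := by
    rw [chiR, commutator_le]
    rintro x hx _ ⟨h, rfl⟩
    have : ⁅chiG1 G, chiL G⁆ ≤ (centralizer {QuotientGroup.mk' T (chiIota2 G h)}).comap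
        (QuotientGroup.mk' T) := by
      rw [commutator_le]
      rintro _ ⟨g, rfl⟩ l hl
      rw [← commutatorElement_inv]
      apply inv_mem
      have := (QuotientGroup.eq_one_iff _).2 (main g h l hl)
      change QuotientGroup.mk' T _ = 1 at this
      rw [map_commutatorElement, commutatorElement_eq_one_iff_mul_comm] at this
      rw [mem_comap, mem_centralizer_singleton_iff]
      exact this
    have h2 := this hx
    rw [mem_comap, mem_centralizer_singleton_iff] at h2
    apply (QuotientGroup.eq_one_iff _).1
    change QuotientGroup.mk' T _ = 1
    rw [map_commutatorElement, commutatorElement_eq_one_iff_mul_comm]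
    exact h2
  intro x hx
  exact isOfFinOrder_iff_pow_eq_one.1 (RT hx).2.2
end

section
/- If G is a periodic (torsion) group, then for every element x of the subgroup R of the weak commutativity group χ(G) there exists a positive integer n such that x^n ∈ L₁₂ (i.e. the quotient R/L₁₂ is periodic). -/
open Subgroup

open scoped commutatorElement

theorem crossed_one {G V : Type*} [Group G] [AddCommGroup V] (ρ : G →* AddMonoid.End V)
    (f : G → V) (hf : ∀ x y, f (x * y) = f x + ρ x (f y)) : f 1 = 0 := by
  have := hf 1 1
  simpa using this

theorem crossed_pow {G V : Type*} [Group G] [AddCommGroup V] (ρ : G →* AddMonoid.End V)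
    (f : G → V) (hf : ∀ x y, f (x * y) = f x + ρ x (f y)) (x : G)
    (hx : ρ x (f x) = f x) (n : ℕ) : f (x ^ n) = n • f x := by
  induction n with
  | zero => simpa using crossed_one ρ f hf
  | succ n ih => rw [pow_succ', hf, ih, map_nsmul, hx, succ_nsmul']

theorem crossed_fix {G V : Type*} [Group G] [AddCommGroup V]
    (hG : ∀ g : G, ∃ n : ℕ, 0 < n ∧ g ^ n = 1)
    (tf : ∀ (n : ℕ) (v : V), 0 < n → n • v = 0 → v = 0) (ρ : G →* AddMonoid.End V)
    (f : G → V) (hf : ∀ x y, f (x * y) = f x + ρ x (f y)) (x : G)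
    (hx : ρ x (f x) = f x) : f x = 0 := by
  obtain ⟨n, hn, h⟩ := hG x
  have := crossed_pow ρ f hf x hx n
  rw [h, crossed_one ρ f hf] at this
  exact tf n _ hn this.symm

theorem crossed_swap {G V : Type*} [Group G] [AddCommGroup V]
    (hG : ∀ g : G, ∃ n : ℕ, 0 < n ∧ g ^ n = 1)
    (tf : ∀ (n : ℕ) (v : V), 0 < n → n • v = 0 → v = 0) (ρ : G →* AddMonoid.End V)
    (hρ : ∀ x y v, ρ x (ρ y v) = ρ y (ρ x v))
    (f : G → V) (hf : ∀ x y, f (x * y) = f x + ρ x (f y)) (x y : G) :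
    f x + ρ x (f y) = f y + ρ y (f x) := by
  have hc : ∀ v, ρ ⁅x, y⁆ v = v := by
    intro v
    rw [commutatorElement_def]
    have hm : ∀ a b w, ρ (a * b) w = ρ a (ρ b w) := fun a b w => by rw [map_mul]; rfl
    have hi : ∀ a w, ρ a (ρ a⁻¹ w) = w := fun a w => by rw [← hm, mul_inv_cancel, map_one]; rfl
    rw [hm, hm, hm, hρ x y, hi, hi]
  have h0 : f ⁅x, y⁆ = 0 := crossed_fix hG tf ρ f hf _ (hc _)
  have h1 : x * y = ⁅x, y⁆ * (y * x) := by rw [commutatorElement_def]; group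
  rw [← hf, ← hf, h1, hf, h0, hc, zero_add]

theorem key_vanish {G V : Type*} [Group G] [AddCommGroup V]
    (hG : ∀ g : G, ∃ n : ℕ, 0 < n ∧ g ^ n = 1)
    (tf : ∀ (n : ℕ) (v : V), 0 < n → n • v = 0 → v = 0) (ρ : G →* AddMonoid.End V)
    (hρ : ∀ x y v, ρ x (ρ y v) = ρ y (ρ x v))
    (F : G → G → V) (h : G) (k : ℕ) (hk : 0 < k)
    (h1 : ∀ g x y, F (x * y) g = F x g + ρ x (F y g))
    (h2 : ∀ y g x, F y (g * x) = F y g + (ρ y (F g x) - F g x) + F y x)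
    (h3 : ∀ g, F g g = 0)
    (h4 : ∀ x g, ∑ j ∈ Finset.range k, ρ (h ^ j) (F x g) = 0) (x g : G) : F x g = 0 := by
  set m : G → V := fun g => ∑ j ∈ Finset.range k, F (h ^ j) g with hm
  have hA : ∀ x g, k • F x g = m g - ρ x (m g) := by
    intro x g
    have := Finset.sum_congr (rfl : Finset.range k = Finset.range k)
      (fun j _ => crossed_swap hG tf ρ hρ (fun x => F x g) (h1 g) x (h ^ j))
    simp only [Finset.sum_add_distrib, Finset.sum_const, Finset.card_range, h4] at this
    rw [← map_sum] at this
    rw [eq_sub_iff_add_eq]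
    simpa [hm] using this
  have hN : ∀ g, ∑ j ∈ Finset.range k, ρ (h ^ j) (m g) = 0 := by
    intro g
    simp only [hm, map_sum]
    rw [Finset.sum_comm]
    exact Finset.sum_eq_zero (fun j _ => h4 _ _)
  have hmg : ∀ g, ρ g (m g) = m g := by
    intro g
    have := hA g g
    rw [h3, smul_zero] at this
    exact (sub_eq_zero.mp this.symm).symm
  have hmc : ∀ g x, m (g * x) = m g + ρ g (m x) := by
    intro g x
    have hfix : ∀ y, ρ y (m (g * x) - (m g + ρ g (m x))) = m (g * x) - (m g + ρ g (m x)) := by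
      intro y
      have e := congrArg (fun v => k • v) (h2 y g x)
      simp only [smul_add, smul_sub, ← map_nsmul, hA] at e
      simp only [map_sub, map_add] at e ⊢
      have e2 := sub_eq_zero.mpr e
      rw [← sub_eq_zero, ← neg_eq_zero, ← e2]
      abel
    have hs : k • (m (g * x) - (m g + ρ g (m x))) = 0 := by
      have : ∑ j ∈ Finset.range k, ρ (h ^ j) (m (g * x) - (m g + ρ g (m x))) = 0 := by
        simp only [map_sub, map_add, Finset.sum_sub_distrib, Finset.sum_add_distrib, hN,
          hρ _ g, ← map_sum]
        simp
      simp only [hfix, Finset.sum_const, Finset.card_range] at this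
      exact this
    exact sub_eq_zero.mp (tf k _ hk hs)
  have hm0 : ∀ g, m g = 0 := fun g => crossed_fix hG tf ρ m hmc g (hmg g)
  apply tf k _ hk
  rw [hA, hm0]; simp

def ell {G X : Type*} [Group G] [Group X] (i j : G →* X) (g : G) : X := j g * (i g)⁻¹

section
variable {G X : Type*} [Group G] [Group X] (i j : G →* X)

theorem ell_inv (hc : ∀ g, i g * j g = j g * i g) (g : G) : ell i j g⁻¹ = (ell i j g)⁻¹ := by
  unfold ell
  have := hc g
  simp only [map_inv, inv_inv, mul_inv_rev]
  rw [inv_mul_eq_iff_eq_mul, ← mul_assoc, ← hc g]; group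

theorem ell_eq (hc : ∀ g, i g * j g = j g * i g) (g : G) : ell i j g = (i g)⁻¹ * j g := by
  unfold ell
  rw [eq_inv_mul_iff_mul_eq, ← mul_assoc, hc g]; group

theorem i_conj (h k : G) : i h * ell i j k * (i h)⁻¹ = (ell i j h)⁻¹ * ell i j (h * k) := by
  simp only [ell, map_mul]; group

theorem j_conj (h k : G) : j h * ell i j k * (j h)⁻¹ = ell i j (h * k) * (ell i j h)⁻¹ := by
  simp only [ell, map_mul]; group

theorem i_conj' (hc : ∀ g, i g * j g = j g * i g) (h k : G) :
    i h * ell i j k * (i h)⁻¹ = ell i j (k * h⁻¹) * ell i j h := by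
  rw [ell_eq i j hc k, ell_eq i j hc (k * h⁻¹)]
  simp only [ell, map_mul, map_inv]; group

theorem j_conj' (hc : ∀ g, i g * j g = j g * i g) (h k : G) :
    j h * ell i j k * (j h)⁻¹ = ell i j h * ell i j (k * h⁻¹) := by
  rw [ell_eq i j hc k, ell_eq i j hc (k * h⁻¹)]
  simp only [ell, map_mul, map_inv]; group

theorem ij_conj (hc : ∀ g, i g * j g = j g * i g) (g h k : G) :
    i g * (j h * ell i j k * (j h)⁻¹) * (i g)⁻¹ = j h * (i g * ell i j k * (i g)⁻¹) * (j h)⁻¹ := by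
  have e1 : i g * (j h * ell i j k * (j h)⁻¹) * (i g)⁻¹
      = (i g * ell i j (h * k) * (i g)⁻¹) * (i g * ell i j h⁻¹ * (i g)⁻¹) := by
    rw [j_conj, ← ell_inv i j hc]; group
  have e2 : j h * (i g * ell i j k * (i g)⁻¹) * (j h)⁻¹
      = (j h * ell i j (k * g⁻¹) * (j h)⁻¹) * (j h * ell i j g * (j h)⁻¹) := by
    rw [i_conj' i j hc]; group
  rw [e1, e2, i_conj' i j hc, i_conj, j_conj, j_conj' i j hc]
  simp only [mul_assoc]
  simp

theorem normal_of_gen (hgen : i.range ⊔ j.range = ⊤) (N : Subgroup X)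
    (h1 : ∀ g, ∀ n ∈ N, i g * n * (i g)⁻¹ ∈ N) (h2 : ∀ g, ∀ n ∈ N, j g * n * (j g)⁻¹ ∈ N) :
    N.Normal := by
  rw [← normalizer_eq_top_iff, eq_top_iff, ← hgen, sup_le_iff]
  constructor
  · rintro _ ⟨g, rfl⟩
    rw [mem_normalizer_iff]
    refine fun n => ⟨h1 g n, fun hn => ?_⟩
    have := h1 g⁻¹ _ hn
    simpa [mul_assoc] using this
  · rintro _ ⟨g, rfl⟩
    rw [mem_normalizer_iff]
    refine fun n => ⟨h2 g n, fun hn => ?_⟩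
    have := h2 g⁻¹ _ hn
    simpa [mul_assoc] using this

def LL : Subgroup X := Subgroup.closure (Set.range (ell i j))

theorem ell_mem (g : G) : ell i j g ∈ LL i j := Subgroup.subset_closure ⟨g, rfl⟩

theorem LL_normal (hgen : i.range ⊔ j.range = ⊤) : (LL i j).Normal := by
  have key : ∀ x : X, (∀ g, x * ell i j g * x⁻¹ ∈ LL i j) → ∀ n ∈ LL i j, x * n * x⁻¹ ∈ LL i j := by
    intro x hx
    have : LL i j ≤ (LL i j).comap (MulAut.conj x).toMonoidHom := by
      conv_lhs => unfold LL
      rw [Subgroup.closure_le]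
      rintro _ ⟨g, rfl⟩
      exact hx g
    exact fun n hn => this hn
  apply normal_of_gen i j hgen
  · intro g
    refine key _ (fun k => ?_)
    rw [i_conj]
    exact mul_mem (inv_mem (ell_mem i j _)) (ell_mem i j _)
  · intro g
    refine key _ (fun k => ?_)
    rw [j_conj]
    exact mul_mem (ell_mem i j _) (inv_mem (ell_mem i j _))

theorem comm_LL (hc : ∀ g, i g * j g = j g * i g) (g h : G) :
    ∀ m ∈ LL i j, Commute ⁅i g, j h⁆ m := by
  have : LL i j ≤ Subgroup.centralizer {⁅i g, j h⁆} := by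
    unfold LL
    rw [Subgroup.closure_le]
    rintro _ ⟨k, rfl⟩
    rw [SetLike.mem_coe, Subgroup.mem_centralizer_singleton_iff]
    have e1 : ∀ v, i g * (j h * v * (j h)⁻¹) * (i g)⁻¹
      = ⁅i g, j h⁆ * (j h * (i g * v * (i g)⁻¹) * (j h)⁻¹) * ⁅i g, j h⁆⁻¹ := by
      intro v; rw [commutatorElement_def]; group
    have hall : ∀ v ∈ LL i j, i g * (j h * v * (j h)⁻¹) * (i g)⁻¹
        = j h * (i g * v * (i g)⁻¹) * (j h)⁻¹ := by
      intro v hv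
      have : LL i j ≤ MonoidHom.eqLocus (MulAut.conj (i g * j h)).toMonoidHom
          (MulAut.conj (j h * i g)).toMonoidHom := by
        unfold LL
        rw [Subgroup.closure_le]
        rintro _ ⟨k, rfl⟩
        have := ij_conj i j hc g h k
        change (i g * j h) * _ * (i g * j h)⁻¹ = (j h * i g) * _ * (j h * i g)⁻¹
        simpa [mul_assoc] using this
      have h2 : (i g * j h) * _ * (i g * j h)⁻¹ = (j h * i g) * _ * (j h * i g)⁻¹ := this hv
      simpa [mul_assoc] using h2
    have hk : (i g)⁻¹ * ((j h)⁻¹ * ell i j k * (j h)) * i g ∈ LL i j := by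
      have a1 := j_conj i j h⁻¹ k
      have a2 : (j h)⁻¹ * ell i j k * (j h) = ell i j (h⁻¹ * k) * (ell i j h⁻¹)⁻¹ := by
        simpa using a1
      have b1 := i_conj i j g⁻¹ (h⁻¹ * k)
      have b2 := i_conj i j g⁻¹ (h⁻¹)
      have : (i g)⁻¹ * ((j h)⁻¹ * ell i j k * (j h)) * i g =
        (i g⁻¹ * ell i j (h⁻¹ * k) * (i g⁻¹)⁻¹) * (i g⁻¹ * ell i j (h⁻¹) * (i g⁻¹)⁻¹)⁻¹ := by
        rw [a2]; simp only [map_inv]; group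
      rw [this, b1, b2]
      exact mul_mem (mul_mem (inv_mem (ell_mem i j _)) (ell_mem i j _))
        (inv_mem (mul_mem (inv_mem (ell_mem i j _)) (ell_mem i j _)))
    have e3 := hall _ hk
    rw [e1] at e3
    have e4 : j h * (i g * ((i g)⁻¹ * ((j h)⁻¹ * ell i j k * j h) * i g) * (i g)⁻¹) * (j h)⁻¹
      = ell i j k := by group
    rw [e4] at e3
    exact (mul_inv_eq_iff_eq_mul.mp e3).symm
  intro m hm
  have := this hm
  rw [Subgroup.mem_centralizer_singleton_iff] at this
  exact this.symm

def CC : Subgroup X := Subgroup.centralizer (LL i j : Set X)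

def WW : Subgroup X := LL i j ⊓ CC i j

theorem CC_comm {c m : X} (hcc : c ∈ CC i j) (hm : m ∈ LL i j) : c * m = m * c :=
  (Subgroup.mem_centralizer_iff.mp hcc m hm).symm

theorem CC_normal (hgen : i.range ⊔ j.range = ⊤) : (CC i j).Normal := by
  have := LL_normal i j hgen
  unfold CC
  infer_instance

theorem WW_normal (hgen : i.range ⊔ j.range = ⊤) : (WW i j).Normal := by
  have := LL_normal i j hgen
  have := CC_normal i j hgen
  unfold WW
  infer_instance

theorem comm_mem_CC (hc : ∀ g, i g * j g = j g * i g) (g h : G) : ⁅i g, j h⁆ ∈ CC i j :=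
  Subgroup.mem_centralizer_iff.mpr fun m hm => ((comm_LL i j hc g h m hm).eq).symm

theorem comm_mem_CC' (hc : ∀ g, i g * j g = j g * i g) (g h : G) : ⁅j h, i g⁆ ∈ CC i j := by
  rw [← commutatorElement_inv]; exact inv_mem (comm_mem_CC i j hc g h)

def L1 : Subgroup X := ⁅LL i j, i.range⁆
def L2 : Subgroup X := ⁅LL i j, j.range⁆

theorem L1_normal (hgen : i.range ⊔ j.range = ⊤) : (L1 i j).Normal := by
  rw [← normalizer_eq_top_iff, eq_top_iff]
  have h1 : LL i j ≤ normalizer (L1 i j : Set X) := normalizer_commutator_ge_left _ _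
  have h2 : i.range ≤ normalizer (L1 i j : Set X) := normalizer_commutator_ge_right _ _
  rw [← hgen, sup_le_iff]
  refine ⟨h2, ?_⟩
  rintro _ ⟨g, rfl⟩
  have : j g = ell i j g * i g := by simp [ell]
  rw [this]
  exact mul_mem (h1 (ell_mem i j g)) (h2 ⟨g, rfl⟩)

theorem L2_normal (hgen : i.range ⊔ j.range = ⊤) : (L2 i j).Normal := by
  rw [← normalizer_eq_top_iff, eq_top_iff]
  have h1 : LL i j ≤ normalizer (L2 i j : Set X) := normalizer_commutator_ge_left _ _
  have h2 : j.range ≤ normalizer (L2 i j : Set X) := normalizer_commutator_ge_right _ _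
  rw [← hgen, sup_le_iff]
  refine ⟨?_, h2⟩
  rintro _ ⟨g, rfl⟩
  have : i g = (ell i j g)⁻¹ * j g := by simp [ell]
  rw [this]
  exact mul_mem (inv_mem (h1 (ell_mem i j g))) (h2 ⟨g, rfl⟩)

theorem L1_le (hgen : i.range ⊔ j.range = ⊤) : L1 i j ≤ LL i j := by
  have := LL_normal i j hgen
  exact commutator_le_left _ _

theorem theta_mem (hc : ∀ g, i g * j g = j g * i g) (hgen : i.range ⊔ j.range = ⊤) (h : G)
    {a : X} (ha : a ∈ L1 i j) : ⁅j h, a⁆ ∈ WW i j := by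
  have hL := LL_normal i j hgen
  have hC := CC_normal i j hgen
  have hkey : ∀ g : G, ∀ b ∈ i.range ⊔ CC i j, ⁅j g, b⁆ ∈ CC i j := by
    intro g b hb
    have : i.range ⊔ CC i j ≤ (Subgroup.centralizer {QuotientGroup.mk' (CC i j) (j g)}).comap
        (QuotientGroup.mk' (CC i j)) := by
      rw [sup_le_iff]
      constructor
      · rintro _ ⟨x, rfl⟩
        rw [Subgroup.mem_comap, Subgroup.mem_centralizer_singleton_iff]
        apply Eq.symm
        rw [← commutatorElement_eq_one_iff_mul_comm, ← map_commutatorElement]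
        exact (QuotientGroup.eq_one_iff _).mpr (comm_mem_CC' i j hc x g)
      · intro x hx
        have hx1 : QuotientGroup.mk' (CC i j) x = 1 := (QuotientGroup.eq_one_iff _).mpr hx
        rw [Subgroup.mem_comap, Subgroup.mem_centralizer_singleton_iff, hx1, one_mul, mul_one]
    have hb2 := this hb
    rw [Subgroup.mem_comap, Subgroup.mem_centralizer_singleton_iff] at hb2
    have hb3 := hb2.symm
    rw [← commutatorElement_eq_one_iff_mul_comm, ← map_commutatorElement] at hb3
    exact (QuotientGroup.eq_one_iff _).mp hb3
  have hN : (i.range ⊔ CC i j).Normal := by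
    rw [← normalizer_eq_top_iff, eq_top_iff]
    conv_lhs => rw [← hgen]
    rw [sup_le_iff]
    constructor
    · exact le_trans le_sup_left le_normalizer
    · rw [le_normalizer_iff_commutator_le_right, commutator_le]
      rintro _ ⟨g, rfl⟩ b hb
      exact (le_sup_right : CC i j ≤ _) (hkey g b hb)
  have hle : L1 i j ≤ i.range ⊔ CC i j :=
    le_trans (commutator_mono le_rfl le_sup_left) (commutator_le_right (LL i j) (i.range ⊔ CC i j))
  have h1 : ⁅j h, a⁆ ∈ LL i j := by
    rw [commutatorElement_def]
    exact mul_mem (hL.conj_mem _ (L1_le i j hgen ha) _) (inv_mem (L1_le i j hgen ha))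
  exact ⟨h1, hkey h a (hle ha)⟩

theorem theta_mul (hc : ∀ g, i g * j g = j g * i g) (hgen : i.range ⊔ j.range = ⊤) (h : G)
    {a b : X} (ha : a ∈ L1 i j) (hb : b ∈ L1 i j) :
    ⁅j h, a * b⁆ = ⁅j h, a⁆ * ⁅j h, b⁆ := by
  have := CC_comm i j (theta_mem i j hc hgen h hb).2 (L1_le i j hgen ha)
  calc ⁅j h, a * b⁆ = ⁅j h, a⁆ * (a * ⁅j h, b⁆ * a⁻¹) := by
        simp only [commutatorElement_def]; group
    _ = _ := by rw [← this]; group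

theorem theta_inv (hc : ∀ g, i g * j g = j g * i g) (hgen : i.range ⊔ j.range = ⊤) (h : G)
    {a : X} (ha : a ∈ L1 i j) : ⁅j h, a⁻¹⁆ = ⁅j h, a⁆⁻¹ := by
  have := theta_mul i j hc hgen h ha (inv_mem ha)
  rw [mul_inv_cancel, commutatorElement_one_right] at this
  exact eq_inv_of_mul_eq_one_right this.symm

theorem theta_conj (hc : ∀ g, i g * j g = j g * i g) (hgen : i.range ⊔ j.range = ⊤) (h x : G)
    {a : X} (ha : a ∈ L1 i j) :
    ⁅j h, i x * a * (i x)⁻¹⁆ = i x * ⁅j h, a⁆ * (i x)⁻¹ := by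
  have h1 := CC_comm i j (comm_mem_CC' i j hc x⁻¹ h⁻¹) (L1_le i j hgen ha)
  have h2 : ⁅⁅j h⁻¹, i x⁻¹⁆, a⁆ = 1 := commutatorElement_eq_one_iff_mul_comm.mpr h1
  calc ⁅j h, i x * a * (i x)⁻¹⁆
      = i x * (j h * ⁅⁅j h⁻¹, i x⁻¹⁆, a⁆ * (j h)⁻¹ * ⁅j h, a⁆) * (i x)⁻¹ := by
        simp only [commutatorElement_def, map_inv]; group
    _ = _ := by rw [h2]; group

theorem theta_conjL (hgen : i.range ⊔ j.range = ⊤) (h : G)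
    {a m : X} (ha : a ∈ L1 i j) (hm : m ∈ LL i j) :
    ∃ t ∈ ⁅L1 i j, L2 i j⁆, ⁅j h, m * a * m⁻¹⁆ = t * (m * ⁅j h, a⁆ * m⁻¹) := by
  have := L1_normal i j hgen
  have := L2_normal i j hgen
  have hn : (⁅L1 i j, L2 i j⁆).Normal := inferInstance
  refine ⟨m * (j h * ⁅⁅j h⁻¹, m⁻¹⁆, a⁆ * (j h)⁻¹) * m⁻¹, ?_, ?_⟩
  · refine hn.conj_mem _ (hn.conj_mem _ ?_ _) _
    rw [commutator_comm]
    refine commutator_mem_commutator ?_ ha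
    unfold L2
    rw [commutator_comm]
    exact commutator_mem_commutator ⟨_, rfl⟩ (inv_mem hm)
  · simp only [commutatorElement_def, map_inv]; group

theorem WW_comm {u v : X} (hu : u ∈ WW i j) (hv : v ∈ WW i j) : u * v = v * u :=
  CC_comm i j hu.2 hv.1

theorem act_eq (hgen : i.range ⊔ j.range = ⊤) (x : G) {w : X} (hw : w ∈ WW i j) :
    j x * w * (j x)⁻¹ = i x * w * (i x)⁻¹ := by
  have h1 := CC_comm i j ((WW_normal i j hgen).conj_mem _ hw (i x)).2 (ell_mem i j x)
  calc j x * w * (j x)⁻¹ = ell i j x * (i x * w * (i x)⁻¹) * (ell i j x)⁻¹ := by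
        simp only [ell]; group
    _ = _ := by rw [← h1]; group

theorem act_comm (hc : ∀ g, i g * j g = j g * i g) (hgen : i.range ⊔ j.range = ⊤) (x y : G)
    {w : X} (hw : w ∈ WW i j) :
    i x * (i y * w * (i y)⁻¹) * (i x)⁻¹ = i y * (i x * w * (i x)⁻¹) * (i y)⁻¹ := by
  have hn := WW_normal i j hgen
  rw [← act_eq i j hgen y hw, ← act_eq i j hgen y (hn.conj_mem _ hw _)]
  have h1 := CC_comm i j (comm_mem_CC i j hc x y)
    (hn.conj_mem _ (hn.conj_mem _ hw (i x)) (j y)).1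
  calc _ = ⁅i x, j y⁆ * (j y * (i x * w * (i x)⁻¹) * (j y)⁻¹) * ⁅i x, j y⁆⁻¹ := by
        simp only [commutatorElement_def]; group
    _ = _ := by rw [h1]; group

def TT : Subgroup X where
  carrier := {w | w ∈ WW i j ∧ ∃ n : ℕ, 0 < n ∧ w ^ n ∈ ⁅L1 i j, L2 i j⁆}
  one_mem' := ⟨one_mem _, 1, one_pos, by simp [one_mem]⟩
  mul_mem' := by
    rintro a b ⟨ha, n, hn, hna⟩ ⟨hb, m, hm, hmb⟩
    refine ⟨mul_mem ha hb, n * m, Nat.mul_pos hn hm, ?_⟩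
    rw [(show Commute a b from WW_comm i j ha hb).mul_pow, pow_mul, mul_comm n m, pow_mul b]
    exact mul_mem (pow_mem hna _) (pow_mem hmb _)
  inv_mem' := by
    rintro a ⟨ha, n, hn, hna⟩
    exact ⟨inv_mem ha, n, hn, by rw [inv_pow]; exact inv_mem hna⟩

theorem TT_normal (hgen : i.range ⊔ j.range = ⊤) : (TT i j).Normal := by
  have := L1_normal i j hgen
  have := L2_normal i j hgen
  have hn : (⁅L1 i j, L2 i j⁆).Normal := inferInstance
  refine ⟨?_⟩
  rintro a ⟨ha, n, hn1, hna⟩ g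
  refine ⟨(WW_normal i j hgen).conj_mem _ ha _, n, hn1, ?_⟩
  rw [conj_pow]
  exact hn.conj_mem _ hna _

theorem theta_conjT (hc : ∀ g, i g * j g = j g * i g) (hgen : i.range ⊔ j.range = ⊤) (h : G)
    {a m : X} (ha : a ∈ L1 i j) (hm : m ∈ LL i j) :
    ∃ t ∈ TT i j, ⁅j h, m * a * m⁻¹⁆ = t * ⁅j h, a⁆ := by
  obtain ⟨t, ht, e⟩ := theta_conjL i j hgen h ha hm
  have h1 := CC_comm i j (theta_mem i j hc hgen h ha).2 hm
  have h2 : m * ⁅j h, a⁆ * m⁻¹ = ⁅j h, a⁆ := by rw [← h1]; group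
  rw [h2] at e
  refine ⟨t, ⟨?_, 1, one_pos, by simpa using ht⟩, e⟩
  rw [← mul_inv_eq_iff_eq_mul] at e
  rw [← e]
  exact mul_mem (theta_mem i j hc hgen h ((L1_normal i j hgen).conj_mem _ ha _))
    (inv_mem (theta_mem i j hc hgen h ha))

theorem comm_mem_L1 (x : G) {m : X} (hm : m ∈ LL i j) : ⁅i x, m⁆ ∈ L1 i j := by
  unfold L1
  rw [commutator_comm]
  exact commutator_mem_commutator ⟨_, rfl⟩ hm

def rhoEnd {Q : Type*} [Group Q] (N : Subgroup Q) [N.Normal] :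
    Q →* AddMonoid.End (Additive N) where
  toFun q := MonoidHom.toAdditive (MulAut.conjNormal (H := N) q).toMonoidHom
  map_one' := by
    rw [map_one]; rfl
  map_mul' a b := by
    rw [map_mul]; rfl

theorem rhoEnd_coe {Q : Type*} [Group Q] (N : Subgroup Q) [N.Normal]
    (q : Q) (v : Additive N) :
    ((rhoEnd N q v).toMul : Q) = q * (v.toMul : Q) * q⁻¹ := rfl

theorem theta_ell_mem (hG : ∀ g : G, ∃ n : ℕ, 0 < n ∧ g ^ n = 1)
    (hc : ∀ g, i g * j g = j g * i g) (hgen : i.range ⊔ j.range = ⊤) (h x g : G) :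
    ⁅j h, ⁅i x, ell i j g⁆⁆ ∈ TT i j := by
  have hTn := TT_normal i j hgen
  have hWn := WW_normal i j hgen
  have hL1n := L1_normal i j hgen
  let q : X →* X ⧸ TT i j := QuotientGroup.mk' (TT i j)
  have hq1 : ∀ t, q t = 1 ↔ t ∈ TT i j := fun t => QuotientGroup.eq_one_iff t
  let N : Subgroup (X ⧸ TT i j) := (WW i j).map q
  have hNn : N.Normal := hWn.map q (QuotientGroup.mk'_surjective _)
  have hNc : ∀ a b : N, a * b = b * a := by
    rintro ⟨_, u, hu, rfl⟩ ⟨_, v, hv, rfl⟩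
    apply Subtype.ext
    change q u * q v = q v * q u
    rw [← map_mul, ← map_mul, WW_comm i j hu hv]
  let _ : CommGroup N := { (inferInstance : Group N) with mul_comm := hNc }
  have ext_N : ∀ u v : Additive N, (u.toMul : X ⧸ TT i j) = v.toMul → u = v := by
    intro u v huv
    exact Additive.toMul.injective (Subtype.ext huv)
  have hL : ∀ x g, ⁅i x, ell i j g⁆ ∈ L1 i j := fun x g => comm_mem_L1 i j x (ell_mem i j g)
  let F : G → G → Additive N := fun x g => Additive.ofMul
    ⟨q ⁅j h, ⁅i x, ell i j g⁆⁆, Subgroup.mem_map_of_mem q (theta_mem i j hc hgen h (hL x g))⟩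
  let ρ : G →* AddMonoid.End (Additive N) := (rhoEnd N).comp (q.comp i)
  have hρ_coe : ∀ x v, ((ρ x v).toMul : X ⧸ TT i j) = q (i x) * (v.toMul : X ⧸ TT i j) * (q (i x))⁻¹ :=
    fun x v => rfl
  have hF_coe : ∀ x g, ((F x g).toMul : X ⧸ TT i j) = q ⁅j h, ⁅i x, ell i j g⁆⁆ := fun x g => rfl
  have hadd : ∀ u v : Additive N, ((u + v).toMul : X ⧸ TT i j) = u.toMul * v.toMul := fun u v => rfl
  have hneg : ∀ u v : Additive N, ((u - v).toMul : X ⧸ TT i j) = u.toMul * (v.toMul : X ⧸ TT i j)⁻¹ := by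
    intro u v
    rw [sub_eq_add_neg]; rfl
  have hzero : ((0 : Additive N).toMul : X ⧸ TT i j) = 1 := rfl
  obtain ⟨k, hk, hhk⟩ := hG h
  have tf : ∀ (n : ℕ) (v : Additive N), 0 < n → n • v = 0 → v = 0 := by
    rintro n ⟨_, w, hw, rfl⟩ hn hv
    apply ext_N
    have h0 : q w ^ n = 1 := congrArg (fun v : Additive N => (v.toMul : X ⧸ TT i j)) hv
    rw [← map_pow, hq1] at h0
    obtain ⟨-, m, hm, hwm⟩ := h0
    change q w = 1
    rw [hq1]
    exact ⟨hw, n * m, Nat.mul_pos hn hm, by rw [pow_mul]; exact hwm⟩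
  have hqL : ∀ a m, a ∈ L1 i j → m ∈ LL i j → q ⁅j h, m * a * m⁻¹⁆ = q ⁅j h, a⁆ := by
    intro a m ha hm
    obtain ⟨t, ht, e⟩ := theta_conjT i j hc hgen h ha hm
    rw [e, map_mul, (hq1 t).mpr ht, one_mul]
  have key := key_vanish hG tf ρ ?_ F h k hk ?_ ?_ ?_ ?_ x g
  · have := congrArg (fun v : Additive N => (v.toMul : X ⧸ TT i j)) key
    exact (hq1 _).mp this
  · rintro x y ⟨_, w, hw, rfl⟩
    apply ext_N
    change q (i x) * (q (i y) * q w * (q (i y))⁻¹) * (q (i x))⁻¹ =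
      q (i y) * (q (i x) * q w * (q (i x))⁻¹) * (q (i y))⁻¹
    have := congrArg q (act_comm i j hc hgen x y hw)
    simpa only [map_mul, map_inv] using this
  · intro g x y
    rw [add_comm]
    apply ext_N
    rw [hadd, hρ_coe, hF_coe, hF_coe, hF_coe]
    have e : ⁅i (x * y), ell i j g⁆ = (i x * ⁅i y, ell i j g⁆ * (i x)⁻¹) * ⁅i x, ell i j g⁆ := by
      simp only [commutatorElement_def, map_mul]; group
    rw [e, theta_mul i j hc hgen h (hL1n.conj_mem _ (hL y g) _) (hL x g),
      theta_conj i j hc hgen h x (hL y g)]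
    simp only [map_mul, map_inv]
  · intro y g x
    apply ext_N
    rw [hadd, hadd, hneg, hρ_coe]
    simp only [hF_coe]
    have hc1 := hL g x
    have hLc := L1_le i j hgen hc1
    have e : ⁅i y, ell i j (g * x)⁆ = ⁅i y, ell i j g⁆ * (ell i j g *
        ((i y * ⁅i g, ell i j x⁆ * (i y)⁻¹) * ⁅i g, ell i j x⁆⁻¹ *
          (⁅i g, ell i j x⁆ * ⁅i y, ell i j x⁆ * ⁅i g, ell i j x⁆⁻¹)) * (ell i j g)⁻¹) := by
      have e0 : ell i j (g * x) = ell i j g * (⁅i g, ell i j x⁆ * ell i j x) := by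
        simp only [commutatorElement_def, ell, map_mul]; group
      rw [e0]
      generalize ⁅i g, ell i j x⁆ = c
      generalize ell i j x = u
      generalize ell i j g = v
      simp only [commutatorElement_def]; group
    have m1 := hL1n.conj_mem _ hc1 (i y)
    have m2 := hL1n.conj_mem _ (hL y x) ⁅i g, ell i j x⁆
    have m3 := mul_mem m1 (inv_mem hc1)
    have m4 := mul_mem m3 m2
    have m5 := hL1n.conj_mem _ m4 (ell i j g)
    rw [e, theta_mul i j hc hgen h (hL y g) m5, map_mul, hqL _ _ m4 (ell_mem i j g),
      theta_mul i j hc hgen h m3 m2, theta_mul i j hc hgen h m1 (inv_mem hc1),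
      theta_inv i j hc hgen h hc1, theta_conj i j hc hgen h y hc1, map_mul,
      hqL _ _ (hL y x) hLc]
    simp only [map_mul, map_inv, mul_assoc]
  · intro g
    apply ext_N
    have : ⁅i g, ell i j g⁆ = 1 := by
      rw [commutatorElement_eq_one_iff_mul_comm]
      unfold ell
      rw [← mul_assoc, hc g]; group
    rw [hF_coe, this, commutatorElement_one_right, map_one, hzero]
  · intro x g
    have hs : ∀ n : ℕ, ((∑ s ∈ Finset.range n, ρ (h ^ s) (F x g)).toMul : X ⧸ TT i j)
        = q ⁅(j h) ^ n, ⁅i x, ell i j g⁆⁆ := by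
      intro n
      induction n with
      | zero => simp
      | succ n ih =>
        rw [Finset.sum_range_succ, add_comm, hadd, ih, hρ_coe, hF_coe]
        have e : ⁅(j h) ^ (n + 1), ⁅i x, ell i j g⁆⁆ =
            (j (h ^ n) * ⁅j h, ⁅i x, ell i j g⁆⁆ * (j (h ^ n))⁻¹) *
              ⁅(j h) ^ n, ⁅i x, ell i j g⁆⁆ := by
          rw [pow_succ, map_pow]
          generalize (j h) ^ n = z
          generalize ⁅i x, ell i j g⁆ = c
          simp only [commutatorElement_def]; group
        rw [e, act_eq i j hgen _ (theta_mem i j hc hgen h (hL x g))]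
        simp only [map_mul, map_inv]
    apply ext_N
    rw [hs, ← map_pow, hhk, map_one, commutatorElement_one_left, map_one, hzero]

theorem theta_L1_mem (hG : ∀ g : G, ∃ n : ℕ, 0 < n ∧ g ^ n = 1)
    (hc : ∀ g, i g * j g = j g * i g) (hgen : i.range ⊔ j.range = ⊤) (h : G) :
    ∀ a ∈ L1 i j, ⁅j h, a⁆ ∈ TT i j := by
  have hL1n := L1_normal i j hgen
  -- step 1: all generators
  have hT : ∀ a ∈ L1 i j, ∀ m ∈ LL i j, ⁅j h, a⁆ ∈ TT i j → ⁅j h, m * a * m⁻¹⁆ ∈ TT i j := by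
    intro a ha m hm hat
    obtain ⟨t, ht, e⟩ := theta_conjT i j hc hgen h ha hm
    rw [e]; exact mul_mem ht hat
  have step : ∀ x : G, ∀ m ∈ LL i j, ⁅j h, ⁅i x, m⁆⁆ ∈ TT i j := by
    intro x m hm
    have hm' : m ∈ Subgroup.closure (Set.range (ell i j)) := hm
    induction hm' using Subgroup.closure_induction with
    | mem y hy =>
      obtain ⟨g, rfl⟩ := hy
      exact theta_ell_mem i j hG hc hgen h x g
    | one => simp [one_mem]
    | mul u v hu hv ihu ihv =>
      have e : ⁅i x, u * v⁆ = ⁅i x, u⁆ * (u * ⁅i x, v⁆ * u⁻¹) := by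
        simp only [commutatorElement_def]; group
      rw [e, theta_mul i j hc hgen h (comm_mem_L1 i j x hu)
        (hL1n.conj_mem _ (comm_mem_L1 i j x hv) _)]
      exact mul_mem (ihu hu) (hT _ (comm_mem_L1 i j x hv) _ hu (ihv hv))
    | inv u hu ihu =>
      have e : ⁅i x, u⁻¹⁆ = u⁻¹ * ⁅i x, u⁆⁻¹ * u⁻¹⁻¹ := by
        simp only [commutatorElement_def]; group
      rw [e]
      refine hT _ (inv_mem (comm_mem_L1 i j x hu)) _ (inv_mem hu) ?_
      rw [theta_inv i j hc hgen h (comm_mem_L1 i j x hu)]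
      exact inv_mem (ihu hu)
  intro a ha
  have ha' : a ∈ ⁅i.range, LL i j⁆ := by rw [commutator_comm]; exact ha
  rw [Subgroup.commutator_def] at ha'
  have : ∀ u, u ∈ Subgroup.closure {g | ∃ g₁ ∈ i.range, ∃ g₂ ∈ LL i j, ⁅g₁, g₂⁆ = g} →
      u ∈ L1 i j := by
    intro u hu
    rw [← Subgroup.commutator_def, commutator_comm] at hu
    exact hu
  induction ha' using Subgroup.closure_induction with
  | mem y hy =>
    obtain ⟨_, ⟨x, rfl⟩, m, hm, rfl⟩ := hy
    exact step x m hm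
  | one => simp [one_mem]
  | mul u v hu hv ihu ihv =>
    rw [theta_mul i j hc hgen h (this u hu) (this v hv)]
    exact mul_mem (ihu (this u hu)) (ihv (this v hv))
  | inv u hu ihu =>
    rw [theta_inv i j hc hgen h (this u hu)]
    exact inv_mem (ihu (this u hu))

theorem R_periodic (hG : ∀ g : G, ∃ n : ℕ, 0 < n ∧ g ^ n = 1)
    (hc : ∀ g, i g * j g = j g * i g) (hgen : i.range ⊔ j.range = ⊤) :
    ⁅⁅i.range, LL i j⁆, j.range⁆ ≤ TT i j := by
  rw [commutator_le]
  rintro a ha _ ⟨h, rfl⟩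
  rw [← commutatorElement_inv]
  refine inv_mem (theta_L1_mem i j hG hc hgen h a ?_)
  rw [commutator_comm] at ha
  exact ha

end

theorem chiR_mod_L12_periodic (G : Type*) [Group G]
    (hG : ∀ g : G, ∃ n : ℕ, 0 < n ∧ g ^ n = 1) :
    ∀ x ∈ chiR G, ∃ n : ℕ, 0 < n ∧ x ^ n ∈ chiL12 G := by
  have hc : ∀ g, chiIota1 G g * chiIota2 G g = chiIota2 G g * chiIota1 G g := by
    intro g
    have h1 : (QuotientGroup.mk' (chiRel G)) (Monoid.Coprod.inl g * Monoid.Coprod.inr g *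
      (Monoid.Coprod.inl g)⁻¹ * (Monoid.Coprod.inr g)⁻¹) = 1 :=
      (QuotientGroup.eq_one_iff _).mpr (Subgroup.subset_normalClosure ⟨g, rfl⟩)
    simp only [map_mul, map_inv] at h1
    rw [mul_inv_eq_one, mul_inv_eq_iff_eq_mul] at h1
    exact h1
  have hgen : (chiIota1 G).range ⊔ (chiIota2 G).range = ⊤ := by
    unfold chiIota1 chiIota2
    have h1 := congrArg (Subgroup.map (QuotientGroup.mk' (chiRel G)))
      (Monoid.Coprod.range_inl_sup_range_inr (G := G) (H := G))
    rw [Subgroup.map_sup, MonoidHom.map_range, MonoidHom.map_range,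
      Subgroup.map_top_of_surjective _ (QuotientGroup.mk'_surjective _)] at h1
    exact h1
  have hL : chiL G = LL (chiIota1 G) (chiIota2 G) := by
    unfold chiL LL
    congr 1
    ext x
    constructor
    · rintro ⟨g, rfl⟩
      exact ⟨g, ell_eq _ _ hc g⟩
    · rintro ⟨g, rfl⟩
      exact ⟨g, ell_eq _ _ hc g⟩
  intro x hx
  unfold chiR chiG1 chiG2 at hx
  rw [hL] at hx
  have h1 := (R_periodic _ _ hG hc hgen hx).2
  unfold chiL12 chiL1 chiL2 chiG1 chiG2
  rw [hL]
  exact h1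
end
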